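/- Let A ∈ ℝ^{n×n} be symmetric with exactly s distinct eigenvalues, let x₀ ∈ ℝⁿ be generic for A (its orthogonal projection onto every eigenspace of A is nonzero), and let k ≥ s. Then the model estimate Â_k = A Π_k satisfies ‖A − Â_k‖_F² = Σ_{λ} ( m(λ) − 1 ) λ², where the sum runs over the distinct eigenvalues λ of A with multiplicity m(λ) = dim ker(A − λ I) greater than one, and ‖·‖_F is the Frobenius norm. -/

import Mathlib

open Matrix

/-- `P` is the orthogonal projection matrix (symmetric and idempotent) onto the
subspace `W` of `ℝⁿ` (with the standard inner product). -/
def IsOrthProjOnto {n : ℕ} (P : Matrix (Fin n) (Fin n) ℝ) (W : Submodule ℝ (Fin n → ℝ)) : Prop :=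
  P.IsSymm ∧ P * P = P ∧ LinearMap.range P.mulVecLin = W

/-- `krylovSpan A x₀ m = span {A^j x₀ : 0 ≤ j ≤ m − 1}` (the span of the first `m` snapshots). -/
def krylovSpan {n : ℕ} (A : Matrix (Fin n) (Fin n) ℝ) (x₀ : Fin n → ℝ) (m : ℕ) :
    Submodule ℝ (Fin n → ℝ) :=
  Submodule.span ℝ (Set.range fun j : Fin m => (A ^ (j : ℕ)).mulVec x₀)

/-- `μ` is an eigenvalue of the real matrix `A`. -/
def IsEigenvalue {n : ℕ} (A : Matrix (Fin n) (Fin n) ℝ) (μ : ℝ) : Prop :=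
  ∃ v : Fin n → ℝ, v ≠ 0 ∧ A.mulVec v = μ • v

/-- The multiplicity of `μ` as an eigenvalue of `A`: `dim ker (A − μ I)`. -/
noncomputable def eigMult {n : ℕ} (A : Matrix (Fin n) (Fin n) ℝ) (μ : ℝ) : ℕ :=
  Module.finrank ℝ (LinearMap.ker (Matrix.mulVecLin (A - μ • 1)))

/-- A matrix that annihilates every eigenvector of a real symmetric matrix vanishes. -/
theorem Matrix.eq_zero_of_mulVec_eigenvector_eq_zero {n : ℕ} {A : Matrix (Fin n) (Fin n) ℝ}
    (hA : A.IsSymm) (M : Matrix (Fin n) (Fin n) ℝ)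
    (h : ∀ (μ : ℝ) (v : Fin n → ℝ), v ≠ 0 → A *ᵥ v = μ • v → M *ᵥ v = 0) : M = 0 := by
  have hH : A.IsHermitian := by
    rw [Matrix.IsHermitian, Matrix.conjTranspose_eq_transpose_of_trivial]
    exact hA
  have hlin : M.mulVecLin ∘ₗ (WithLp.linearEquiv 2 ℝ (Fin n → ℝ)).toLinearMap = 0 := by
    refine hH.eigenvectorBasis.toBasis.ext fun i => ?_
    have h0 : (WithLp.ofLp (hH.eigenvectorBasis i) : Fin n → ℝ) ≠ 0 := fun h0 =>
      hH.eigenvectorBasis.orthonormal.ne_zero i (by ext j; exact congrFun h0 j)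
    simpa using h _ _ h0 (hH.mulVec_eigenvectorBasis i)
  refine Matrix.ext_of_mulVec_single fun i => ?_
  rw [Matrix.zero_mulVec]
  exact LinearMap.congr_fun hlin (WithLp.toLp 2 (Pi.single i 1))

theorem Matrix.pow_mulVec_of_mulVec_eq_smul {n : ℕ} {A : Matrix (Fin n) (Fin n) ℝ}
    {μ : ℝ} {v : Fin n → ℝ} (h : A *ᵥ v = μ • v) (j : ℕ) : A ^ j *ᵥ v = μ ^ j • v := by
  induction j with
  | zero => simp
  | succ j ih =>
    rw [pow_succ, ← Matrix.mulVec_mulVec, h, Matrix.mulVec_smul, ih, smul_smul, pow_succ, mul_comm]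

theorem Matrix.aeval_mulVec_of_mulVec_eq_smul {n : ℕ} {A : Matrix (Fin n) (Fin n) ℝ}
    {μ : ℝ} {v : Fin n → ℝ} (h : A *ᵥ v = μ • v) (p : Polynomial ℝ) :
    Polynomial.aeval A p *ᵥ v = p.eval μ • v := by
  rw [Polynomial.aeval_eq_sum_range, Matrix.sum_mulVec, Polynomial.eval_eq_sum_range,
    Finset.sum_smul]
  refine Finset.sum_congr rfl fun j _ => ?_
  rw [Matrix.smul_mulVec, Matrix.pow_mulVec_of_mulVec_eq_smul h, smul_smul]

theorem aeval_mulVec_mem_krylovSpan {n : ℕ} (A : Matrix (Fin n) (Fin n) ℝ) (x₀ : Fin n → ℝ)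
    {m : ℕ} {p : Polynomial ℝ} (hp : p.natDegree < m) :
    Polynomial.aeval A p *ᵥ x₀ ∈ krylovSpan A x₀ m := by
  rw [Polynomial.aeval_eq_sum_range' hp, Matrix.sum_mulVec]
  refine Submodule.sum_mem _ fun j hj => ?_
  rw [Matrix.smul_mulVec]
  exact Submodule.smul_mem _ _ (Submodule.subset_span ⟨⟨j, Finset.mem_range.mp hj⟩, rfl⟩)

/-- The spectral projection of `A` at `μ`, as a Lagrange polynomial in `A`, where `ev` is the
set of eigenvalues of `A`. -/
noncomputable def spectralProj {n : ℕ} (A : Matrix (Fin n) (Fin n) ℝ) (ev : Finset ℝ) (μ : ℝ) :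
    Matrix (Fin n) (Fin n) ℝ :=
  Polynomial.aeval A (Lagrange.basis ev id μ)

section SpectralProj

variable {n : ℕ} {A : Matrix (Fin n) (Fin n) ℝ} {ev : Finset ℝ}

theorem spectralProj_mulVec {μ ν : ℝ} (hμ : μ ∈ ev) (hν : ν ∈ ev) {v : Fin n → ℝ}
    (h : A *ᵥ v = ν • v) : spectralProj A ev μ *ᵥ v = if μ = ν then v else 0 := by
  rw [spectralProj, Matrix.aeval_mulVec_of_mulVec_eq_smul h]
  split_ifs with hμν
  · subst hμν
    have := Lagrange.eval_basis_self (v := (id : ℝ → ℝ)) (Function.injective_id.injOn) hμ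
    rw [id] at this
    rw [this, one_smul]
  · have := Lagrange.eval_basis_of_ne (v := (id : ℝ → ℝ)) hμν hν
    rw [id] at this
    rw [this, zero_smul]

theorem mul_spectralProj (hA : A.IsSymm) (hev : ∀ μ : ℝ, μ ∈ ev ↔ IsEigenvalue A μ)
    {μ : ℝ} (hμ : μ ∈ ev) : A * spectralProj A ev μ = μ • spectralProj A ev μ := by
  rw [← sub_eq_zero]
  refine Matrix.eq_zero_of_mulVec_eigenvector_eq_zero hA _ fun ν v hv h => ?_
  rw [Matrix.sub_mulVec, Matrix.smul_mulVec, ← Matrix.mulVec_mulVec,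
    spectralProj_mulVec hμ ((hev ν).mpr ⟨v, hv, h⟩) h]
  split_ifs with hμν
  · rw [h, hμν, sub_self]
  · simp

theorem pow_eq_sum_spectralProj (hA : A.IsSymm) (hev : ∀ μ : ℝ, μ ∈ ev ↔ IsEigenvalue A μ)
    (j : ℕ) : A ^ j = ∑ μ ∈ ev, μ ^ j • spectralProj A ev μ := by
  rw [← sub_eq_zero]
  refine Matrix.eq_zero_of_mulVec_eigenvector_eq_zero hA _ fun ν v hv h => ?_
  have hν := (hev ν).mpr ⟨v, hv, h⟩
  have hsum : (∑ μ ∈ ev, μ ^ j • spectralProj A ev μ) *ᵥ v = ν ^ j • v := by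
    rw [Matrix.sum_mulVec, Finset.sum_eq_single_of_mem ν hν]
    · rw [Matrix.smul_mulVec, spectralProj_mulVec hν hν h, if_pos rfl]
    · intro μ hμ hne
      rw [Matrix.smul_mulVec, spectralProj_mulVec hμ hν h, if_neg hne, smul_zero]
  rw [Matrix.sub_mulVec, hsum, Matrix.pow_mulVec_of_mulVec_eq_smul h, sub_self]

theorem trace_spectralProj (hA : A.IsSymm) (hev : ∀ μ : ℝ, μ ∈ ev ↔ IsEigenvalue A μ)
    {μ : ℝ} (hμ : μ ∈ ev) : (spectralProj A ev μ).trace = eigMult A μ := by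
  have hmem : ∀ v : Fin n → ℝ, v ∈ LinearMap.ker (Matrix.mulVecLin (A - μ • 1)) ↔
      A *ᵥ v = μ • v := fun v => by
    rw [LinearMap.mem_ker, Matrix.mulVecLin_apply, Matrix.sub_mulVec, Matrix.smul_mulVec,
      Matrix.one_mulVec, sub_eq_zero]
  have hproj : LinearMap.IsProj (LinearMap.ker (Matrix.mulVecLin (A - μ • 1)))
      (Matrix.toLin' (spectralProj A ev μ)) := by
    refine ⟨fun v => ?_, fun v hv => ?_⟩
    · rw [hmem, Matrix.toLin'_apply, Matrix.mulVec_mulVec, mul_spectralProj hA hev hμ,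
        Matrix.smul_mulVec]
    · rw [Matrix.toLin'_apply, spectralProj_mulVec hμ hμ ((hmem v).mp hv), if_pos rfl]
  rw [← Matrix.trace_toLin'_eq, hproj.trace, eigMult]

end SpectralProj

theorem Matrix.IsSymm.dotProduct_eq_zero_of_eigenvectors {n : ℕ} {A : Matrix (Fin n) (Fin n) ℝ}
    (hA : A.IsSymm) {μ ν : ℝ} (hne : μ ≠ ν) {v w : Fin n → ℝ} (hv : A *ᵥ v = μ • v)
    (hw : A *ᵥ w = ν • w) : v ⬝ᵥ w = 0 := by
  have h : μ * (v ⬝ᵥ w) = ν * (v ⬝ᵥ w) := by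
    calc μ * (v ⬝ᵥ w) = (A *ᵥ v) ⬝ᵥ w := by rw [hv, smul_dotProduct, smul_eq_mul]
      _ = v ⬝ᵥ (A *ᵥ w) := by
        rw [Matrix.dotProduct_mulVec, ← Matrix.mulVec_transpose, hA.eq]
      _ = ν * (v ⬝ᵥ w) := by rw [hw, dotProduct_smul, smul_eq_mul]
  by_contra h0
  exact hne (mul_right_cancel₀ h0 h)

theorem IsOrthProjOnto.mulVec_of_mem {n : ℕ} {P : Matrix (Fin n) (Fin n) ℝ}
    {W : Submodule ℝ (Fin n → ℝ)} (hP : IsOrthProjOnto P W) {v : Fin n → ℝ} (hv : v ∈ W) :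
    P *ᵥ v = v := by
  obtain ⟨u, rfl⟩ := hP.2.2.symm ▸ hv
  rw [Matrix.mulVecLin_apply, Matrix.mulVec_mulVec, hP.2.1]

/-- The orthogonal projection onto the span of finitely many nonzero, pairwise orthogonal
vectors is the sum of the rank-one projections. -/
theorem IsOrthProjOnto.eq_sum_vecMulVec {n : ℕ} {ι : Type*} {P : Matrix (Fin n) (Fin n) ℝ}
    {W : Submodule ℝ (Fin n → ℝ)} (hP : IsOrthProjOnto P W) (t : Finset ι) (w : ι → Fin n → ℝ)
    (hW : W = Submodule.span ℝ (w '' t)) (h0 : ∀ i ∈ t, w i ≠ 0)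
    (horth : ∀ i ∈ t, ∀ j ∈ t, i ≠ j → w i ⬝ᵥ w j = 0) :
    P = ∑ i ∈ t, (w i ⬝ᵥ w i)⁻¹ • vecMulVec (w i) (w i) := by
  set Q := ∑ i ∈ t, (w i ⬝ᵥ w i)⁻¹ • vecMulVec (w i) (w i) with hQ
  have hQsymm : Qᵀ = Q := by
    simp only [hQ, Matrix.transpose_sum, Matrix.transpose_smul, Matrix.transpose_vecMulVec]
  have hPQ : P * Q = Q := by
    rw [hQ, Finset.mul_sum]
    refine Finset.sum_congr rfl fun i hi => ?_
    rw [Matrix.mul_smul, Matrix.mul_vecMulVec, hP.mulVec_of_mem]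
    rw [hW]
    exact Submodule.subset_span ⟨i, hi, rfl⟩
  have hQfix : ∀ v ∈ W, Q *ᵥ v = v := by
    intro v hv
    rw [hW] at hv
    induction hv using Submodule.span_induction with
    | mem v hv =>
      obtain ⟨j, hj, rfl⟩ := hv
      rw [hQ, Matrix.sum_mulVec, Finset.sum_eq_single_of_mem j hj]
      · have : w j ⬝ᵥ w j ≠ 0 := fun h => h0 j hj (dotProduct_self_eq_zero.mp h)
        ext a
        simp [Matrix.smul_mulVec, Matrix.vecMulVec_mulVec]
        field_simp
      · intro i hi hij
        ext a
        simp [Matrix.smul_mulVec, Matrix.vecMulVec_mulVec, horth i hi j hj hij]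
    | zero => simp
    | add x y _ _ hx hy => rw [Matrix.mulVec_add, hx, hy]
    | smul c x _ hx => rw [Matrix.mulVec_smul, hx]
  have hQP : Q * P = P := by
    refine Matrix.ext_of_mulVec_single fun i => ?_
    rw [← Matrix.mulVec_mulVec]
    refine hQfix _ ?_
    rw [← hP.2.2]
    exact ⟨_, rfl⟩
  have := congrArg Matrix.transpose hQP
  rwa [Matrix.transpose_mul, hQsymm, hP.1.eq, hPQ, eq_comm] at this

/-- `A` symmetric with exactly `s` distinct eigenvalues, `x₀` generic for
`A`, and `k ≥ s`.  Then `‖A − Â_k‖_F² = ∑_{λ : m(λ) > 1} (m(λ) − 1) λ²`, the sum running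
over the distinct eigenvalues of `A` of multiplicity greater than one (squared Frobenius
norm written as a trace). -/
theorem stmt_11 {n s k : ℕ} (A : Matrix (Fin n) (Fin n) ℝ) (hA : A.IsSymm)
    (ev : Finset ℝ) (hev : ∀ μ : ℝ, μ ∈ ev ↔ IsEigenvalue A μ) (hcard : ev.card = s)
    (x₀ : Fin n → ℝ)
    (hgen : ∀ μ ∈ ev, ∃ v : Fin n → ℝ, A.mulVec v = μ • v ∧ v ⬝ᵥ x₀ ≠ 0)
    (hk : s ≤ k)
    (Pk : Matrix (Fin n) (Fin n) ℝ)
    (hPk : IsOrthProjOnto Pk (krylovSpan A x₀ (k + 1))) :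
    Matrix.trace ((A - A * Pk)ᵀ * (A - A * Pk))
      = ∑ μ ∈ ev.filter (fun μ => 1 < eigMult A μ), ((eigMult A μ : ℝ) - 1) * μ ^ 2 := by
  set w : ℝ → Fin n → ℝ := fun μ => spectralProj A ev μ *ᵥ x₀ with hw
  have hAw : ∀ μ ∈ ev, A *ᵥ w μ = μ • w μ := fun μ hμ => by
    rw [hw, Matrix.mulVec_mulVec, mul_spectralProj hA hev hμ, Matrix.smul_mulVec]
  have horth : ∀ μ ∈ ev, ∀ ν ∈ ev, μ ≠ ν → w μ ⬝ᵥ w ν = 0 := fun μ hμ ν hν hne =>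
    hA.dotProduct_eq_zero_of_eigenvectors hne (hAw μ hμ) (hAw ν hν)
  have hpow : ∀ j : ℕ, A ^ j *ᵥ x₀ = ∑ μ ∈ ev, μ ^ j • w μ := fun j => by
    rw [pow_eq_sum_spectralProj hA hev j, Matrix.sum_mulVec]
    simp only [Matrix.smul_mulVec, hw]
  have hw0 : ∀ μ ∈ ev, w μ ≠ 0 := fun μ hμ h => by
    obtain ⟨v, hv, hvx⟩ := hgen μ hμ
    have hx := hpow 0
    simp only [pow_zero, Matrix.one_mulVec, one_smul] at hx
    refine hvx ?_
    rw [hx, dotProduct_sum]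
    refine Finset.sum_eq_zero fun ν hν => ?_
    by_cases hne : μ = ν
    · rw [← hne, h, dotProduct_zero]
    · exact hA.dotProduct_eq_zero_of_eigenvectors hne hv (hAw ν hν)
  have hspan : krylovSpan A x₀ (k + 1) = Submodule.span ℝ (w '' ev) := by
    apply le_antisymm
    · rw [krylovSpan, Submodule.span_le]
      rintro _ ⟨j, rfl⟩
      simp only [hpow]
      exact Submodule.sum_mem _ fun μ hμ =>
        Submodule.smul_mem _ _ (Submodule.subset_span ⟨μ, hμ, rfl⟩)
    · rw [Submodule.span_le]
      rintro _ ⟨μ, hμ, rfl⟩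
      refine aeval_mulVec_mem_krylovSpan A x₀ ?_
      rw [Polynomial.natDegree_eq_of_degree_eq_some
        (Lagrange.degree_basis (Function.injective_id.injOn) hμ)]
      omega
  have htrP : (A ^ 2 * Pk).trace = ∑ μ ∈ ev, μ ^ 2 := by
    rw [hPk.eq_sum_vecMulVec ev w hspan hw0 horth, Finset.mul_sum, Matrix.trace_sum]
    refine Finset.sum_congr rfl fun μ hμ => ?_
    have h0 : w μ ⬝ᵥ w μ ≠ 0 := fun h => hw0 μ hμ (dotProduct_self_eq_zero.mp h)
    rw [Matrix.mul_smul, Matrix.mul_vecMulVec, Matrix.pow_mulVec_of_mulVec_eq_smul (hAw μ hμ),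
      Matrix.trace_smul, Matrix.trace_vecMulVec, smul_dotProduct, smul_eq_mul, smul_eq_mul]
    field_simp
  have htrA : (A ^ 2).trace = ∑ μ ∈ ev, μ ^ 2 * eigMult A μ := by
    rw [pow_eq_sum_spectralProj hA hev 2, Matrix.trace_sum]
    refine Finset.sum_congr rfl fun μ hμ => ?_
    rw [Matrix.trace_smul, trace_spectralProj hA hev hμ, smul_eq_mul]
  have hIP : (1 - Pk) * (1 - Pk) = 1 - Pk := IsIdempotentElem.one_sub hPk.2.1
  have htr : ((A - A * Pk)ᵀ * (A - A * Pk)).trace = (A ^ 2).trace - (A ^ 2 * Pk).trace := by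
    have hfac : A - A * Pk = A * (1 - Pk) := by rw [mul_sub, mul_one]
    rw [hfac, Matrix.transpose_mul, Matrix.transpose_sub, Matrix.transpose_one, hPk.1.eq, hA.eq,
      Matrix.trace_mul_comm, mul_assoc, ← mul_assoc (1 - Pk), hIP, Matrix.trace_mul_comm,
      mul_assoc, Matrix.trace_mul_comm, ← pow_two, mul_sub, mul_one, Matrix.trace_sub]
  rw [htr, htrA, htrP, ← Finset.sum_sub_distrib, Finset.sum_filter]
  refine Finset.sum_congr rfl fun μ hμ => ?_
  split_ifs with h1
  · ring
  · have hpos : 0 < eigMult A μ := by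
      refine Module.finrank_pos_iff_exists_ne_zero.mpr ?_
      obtain ⟨v, hv, h⟩ := (hev μ).mp hμ
      refine ⟨⟨v, ?_⟩, fun h0 => hv (congrArg Subtype.val h0)⟩
      rw [LinearMap.mem_ker, Matrix.mulVecLin_apply, Matrix.sub_mulVec, Matrix.smul_mulVec,
        Matrix.one_mulVec, h, sub_self]
    have : eigMult A μ = 1 := by omega
    rw [this]
    simp
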